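/- Let n ≥ 2, let 2 ≤ k ≤ n, α > 0 and N₀ > 0. There exists a constant C₀ > 0 depending only on n, k, α and N₀ with the following property: whenever λ = (λ₁,…,λ_n) ∈ Γ_k satisfies λ₁ ≥ λ₂ ≥ ⋯ ≥ λ_n and S_k(λ) ≤ N₀, then for every 1 ≤ i ≤ n one has C₀ S_k(λ) ≥ λ_i S_k^{ii}(λ). -/

import Mathlib

open scoped BigOperators

/-- The `k`-th elementary symmetric polynomial `σ_k(λ)` of `λ ∈ ℝⁿ`, indexed by `k : ℤ`,
with the conventions `σ₀ = 1` and `σ_k = 0` for `k < 0` or `k > n`. -/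
noncomputable def esymmZ (n : ℕ) (k : ℤ) (lam : Fin n → ℝ) : ℝ :=
  if k < 0 then 0 else ∑ s ∈ Finset.univ.powersetCard k.toNat, ∏ i ∈ s, lam i

/-- `S_k(λ) := σ_k(λ) + α σ_{k-1}(λ)`. -/
noncomputable def SZ (n : ℕ) (α : ℝ) (k : ℤ) (lam : Fin n → ℝ) : ℝ :=
  esymmZ n k lam + α * esymmZ n (k - 1) lam

/-- The Garding cone `Γ_m = {λ ∈ ℝⁿ : σ_j(λ) > 0 for j = 1,…,m}` (so `Γ₀ = ℝⁿ`). -/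
def Gamma (n : ℕ) (m : ℕ) : Set (Fin n → ℝ) :=
  {lam | ∀ j : ℕ, 1 ≤ j → j ≤ m → 0 < esymmZ n j lam}

/-- `Γ̃_k := Γ_{k-1} ∩ {λ : S_k(λ) > 0}`. -/
def GammaTilde (n : ℕ) (α : ℝ) (k : ℕ) : Set (Fin n → ℝ) :=
  Gamma n (k - 1) ∩ {lam | 0 < SZ n α k lam}

/-- `σ_k(λ|i)`: the `k`-th elementary symmetric polynomial of the vector obtained
from `λ` by deleting the entry `λ_i`. -/
noncomputable def esymmDel (n : ℕ) (k : ℤ) (lam : Fin n → ℝ) (i : Fin n) : ℝ :=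
  if k < 0 then 0 else
    ∑ s ∈ (Finset.univ.erase i).powersetCard k.toNat, ∏ j ∈ s, lam j

/-- `S_k(λ|i) := σ_k(λ|i) + α σ_{k-1}(λ|i)`.  In particular
`S_k^{ii}(λ) = ∂S_k/∂λ_i = S_{k-1}(λ|i) = SDel n α (k-1) lam i`. -/
noncomputable def SDel (n : ℕ) (α : ℝ) (k : ℤ) (lam : Fin n → ℝ) (i : Fin n) : ℝ :=
  esymmDel n k lam i + α * esymmDel n (k - 1) lam i

/-- `σ_k(λ|pq)`: the `k`-th elementary symmetric polynomial of the vector obtained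
from `λ` by deleting the entries `λ_p` and `λ_q`. -/
noncomputable def esymmDel2 (n : ℕ) (k : ℤ) (lam : Fin n → ℝ) (p q : Fin n) : ℝ :=
  if k < 0 then 0 else
    ∑ s ∈ ((Finset.univ.erase p).erase q).powersetCard k.toNat, ∏ l ∈ s, lam l

/-- `S_k^{pp,qq}(λ) = ∂²S_k/∂λ_p∂λ_q`, which equals
`σ_{k-2}(λ|pq) + α σ_{k-3}(λ|pq)` for `p ≠ q`, and `0` for `p = q`. -/
noncomputable def Spq (n : ℕ) (α : ℝ) (k : ℤ) (lam : Fin n → ℝ) (p q : Fin n) : ℝ :=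
  if p = q then 0 else esymmDel2 n (k - 2) lam p q + α * esymmDel2 n (k - 3) lam p q

/-- The `k`-th elementary symmetric polynomial of the family `(x i)`, `i ∈ s`. -/
noncomputable def esymmOn {ι : Type*} (x : ι → ℝ) (s : Finset ι) (k : ℕ) : ℝ :=
  ∑ t ∈ s.powersetCard k, ∏ i ∈ t, x i

namespace Polynomial

theorem Splits.derivative_real {p : ℝ[X]} (hp : p.Splits) : p.derivative.Splits := by
  rw [splits_iff_card_roots] at hp ⊢
  have h₁ := card_roots_le_derivative p
  have h₂ := p.derivative.card_roots'
  have h₃ := natDegree_derivative_le p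
  rcases Nat.eq_zero_or_pos p.natDegree with h | h <;> omega

theorem Splits.two_mul_coeff_zero_mul_coeff_two_le {p : ℝ[X]} (hp : p.Splits) :
    2 * (p.coeff 0 * p.coeff 2) ≤ p.coeff 1 ^ 2 := by
  obtain ⟨m, hm⟩ := splits_iff_exists_multiset'.1 hp
  rw [hm]
  generalize p.leadingCoeff = c
  clear hm
  induction m using Multiset.induction with
  | empty => simp [coeff_C]
  | cons r m ih =>
    rw [Multiset.map_cons, Multiset.prod_cons, mul_left_comm (C c)]
    set q := C c * (m.map fun a => X + C a).prod
    have h₀ : ((X + C r) * q).coeff 0 = r * q.coeff 0 := by simp [mul_coeff_zero]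
    have h₁ : ((X + C r) * q).coeff 1 = q.coeff 0 + r * q.coeff 1 := by
      rw [add_mul, coeff_add, coeff_C_mul, coeff_X_mul q 0]
    have h₂ : ((X + C r) * q).coeff 2 = q.coeff 1 + r * q.coeff 2 := by
      rw [add_mul, coeff_add, coeff_C_mul, coeff_X_mul q 1]
    rw [h₀, h₁, h₂]
    nlinarith [mul_nonneg (sq_nonneg r) (sub_nonneg.2 ih), sq_nonneg (q.coeff 0)]

theorem Splits.newton_coeff {p : ℝ[X]} (hp : p.Splits) (k : ℕ) :
    (k + 2) * (p.coeff k * p.coeff (k + 2)) ≤ (k + 1) * p.coeff (k + 1) ^ 2 := by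
  induction k generalizing p with
  | zero => simpa using hp.two_mul_coeff_zero_mul_coeff_two_le
  | succ k ih =>
    have h := ih hp.derivative_real
    simp only [coeff_derivative] at h
    push_cast at h ⊢
    refine le_of_mul_le_mul_left ?_ (by positivity : (0 : ℝ) < (k + 1) * (k + 2))
    linear_combination h

theorem Splits.coeff_mul_coeff_le_sq {p : ℝ[X]} (hp : p.Splits) (k : ℕ) :
    p.coeff k * p.coeff (k + 2) ≤ p.coeff (k + 1) ^ 2 := by
  have h := hp.newton_coeff k
  by_contra! hlt
  have : (0 : ℝ) ≤ k := k.cast_nonneg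
  nlinarith [sq_nonneg (p.coeff (k + 1))]

end Polynomial

section esymmOn

variable {ι : Type*} {x : ι → ℝ}

theorem esymmOn_zero (s : Finset ι) : esymmOn x s 0 = 1 := by
  simp [esymmOn]

theorem esymmOn_one (s : Finset ι) : esymmOn x s 1 = ∑ i ∈ s, x i := by
  simp [esymmOn, Finset.powersetCard_one]

variable [DecidableEq ι]

theorem sum_prod_insert {s : Finset ι} {a : ι} (ha : a ∉ s) (k : ℕ) :
    ∑ t ∈ s.powersetCard k, ∏ i ∈ insert a t, x i = x a * esymmOn x s k := by
  rw [esymmOn, Finset.mul_sum]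
  refine Finset.sum_congr rfl fun t ht => Finset.prod_insert fun h => ha ?_
  exact (Finset.mem_powersetCard.1 ht).1 h

theorem esymmOn_insert {s : Finset ι} {a : ι} (ha : a ∉ s) (k : ℕ) :
    esymmOn x (insert a s) (k + 1) = esymmOn x s (k + 1) + x a * esymmOn x s k := by
  have hs : ∀ t ∈ s.powersetCard k, a ∉ t := fun t ht h =>
    ha ((Finset.mem_powersetCard.1 ht).1 h)
  rw [← sum_prod_insert ha, esymmOn, Finset.powersetCard_succ_insert ha, Finset.sum_union,
    Finset.sum_image, esymmOn]
  · intro t ht u hu h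
    rw [← Finset.erase_insert (hs t ht), h, Finset.erase_insert (hs u hu)]
  · rw [Finset.disjoint_left]
    intro t ht h
    obtain ⟨u, -, rfl⟩ := Finset.mem_image.1 h
    exact ha ((Finset.mem_powersetCard.1 ht).1 (Finset.mem_insert_self a u))

open Polynomial in
theorem coeff_prod_one_add_C_mul_X (s : Finset ι) (k : ℕ) :
    (∏ i ∈ s, (1 + C (x i) * X)).coeff k = esymmOn x s k := by
  induction s using Finset.induction generalizing k with
  | empty =>
    cases k with
    | zero => simp [esymmOn_zero]
    | succ k =>
      have h : (∅ : Finset ι).powersetCard (k + 1) = ∅ := Finset.powersetCard_eq_empty.2 (by simp)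
      simp [esymmOn, coeff_one, h]
  | insert a s ha ih =>
    rw [Finset.prod_insert ha, add_mul, one_mul, mul_assoc, coeff_add, coeff_C_mul]
    cases k with
    | zero => simp [ih, esymmOn_zero]
    | succ k => rw [coeff_X_mul, ih, ih, esymmOn_insert ha]

/-- A weak form of Newton's inequalities. -/
theorem esymmOn_mul_esymmOn_le_sq (s : Finset ι) (k : ℕ) :
    esymmOn x s k * esymmOn x s (k + 2) ≤ esymmOn x s (k + 1) ^ 2 := by
  simp only [← coeff_prod_one_add_C_mul_X]
  refine Polynomial.Splits.coeff_mul_coeff_le_sq (.prod fun i _ => .of_natDegree_le_one ?_) k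
  compute_degree

/-- Deleting an entry of a vector in `Γ_{k+1}` gives a vector in `Γ_k`. -/
theorem esymmOn_pos_of_insert {s : Finset ι} {a : ι} (ha : a ∉ s) {k : ℕ}
    (h : ∀ j ≤ k + 1, 0 < esymmOn x (insert a s) j) : ∀ j ≤ k, 0 < esymmOn x s j := by
  intro j
  induction j with
  | zero => simp [esymmOn_zero]
  | succ j ih =>
    intro hj
    have h₀ := ih (by omega)
    have h₁ := h (j + 1) (by omega)
    have h₂ := h (j + 2) (by omega)
    rw [esymmOn_insert ha] at h₁ h₂
    have hN := esymmOn_mul_esymmOn_le_sq (x := x) s j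
    by_contra! hneg
    generalize esymmOn x s j = p at *
    generalize esymmOn x s (j + 1) = q at *
    generalize esymmOn x s (j + 2) = r at *
    have h₃ := mul_pos h₀ h₂
    have h₄ := mul_nonneg (neg_nonneg.2 hneg) h₁.le
    linarith [show p * (r + x a * q) = p * r + x a * p * q by ring,
      show -q * (q + x a * p) = -q ^ 2 - x a * p * q by ring]

/-- In `Γ_{k+1}`, the product over the `k` largest entries is at most `σ_k`, and the next largest
entry is positive and controls all the remaining ones. -/
theorem exists_prod_le_esymmOn (k : ℕ) (s : Finset ι) (h : ∀ j ≤ k + 1, 0 < esymmOn x s j) :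
    ∃ T ⊆ s, ∃ b ∈ s, T.card = k ∧ 0 < x b ∧ (∀ i ∈ T, x b ≤ x i) ∧
      (∀ i ∈ s \ T, |x i| ≤ s.card * x b) ∧ ∏ i ∈ T, x i ≤ esymmOn x s k := by
  have hsum := h 1 (by omega)
  rw [esymmOn_one] at hsum
  have hne : s.Nonempty := Finset.nonempty_of_sum_ne_zero hsum.ne'
  obtain ⟨a, has, ha⟩ := s.exists_max_image x hne
  induction k generalizing s a with
  | zero =>
    have hpos : 0 < x a := by
      by_contra! hneg
      exact hsum.not_ge (Finset.sum_nonpos fun i hi => (ha i hi).trans hneg)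
    refine ⟨∅, s.empty_subset, a, has, rfl, hpos, by simp, fun i hi => ?_, by simp [esymmOn_zero]⟩
    rw [Finset.sdiff_empty] at hi
    have hcard : (1 : ℝ) ≤ s.card := by exact_mod_cast hne.card_pos
    rw [abs_le]
    constructor
    · have h₁ := Finset.add_sum_erase s x hi
      have h₂ := Finset.sum_le_card_nsmul (s.erase i) x (x a) fun j hj =>
        ha j (Finset.mem_of_mem_erase hj)
      have h₃ : ((s.erase i).card : ℝ) ≤ s.card := by exact_mod_cast Finset.card_erase_le
      rw [nsmul_eq_mul] at h₂
      nlinarith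
    · nlinarith [ha i hi]
  | succ k ih =>
    have hnot : a ∉ s.erase a := s.notMem_erase a
    rw [← Finset.insert_erase has] at h
    have hpos := esymmOn_pos_of_insert hnot h
    have hsum' := hpos 1 (by omega)
    rw [esymmOn_one] at hsum'
    have hne' : (s.erase a).Nonempty := Finset.nonempty_of_sum_ne_zero hsum'.ne'
    obtain ⟨a', ha's, ha'⟩ := (s.erase a).exists_max_image x hne'
    obtain ⟨T, hT, b, hb, hcard, hb₀, hTb, hrest, hprod⟩ :=
      ih (s.erase a) hpos hsum' hne' a' ha's ha'
    have haT : a ∉ T := fun h => hnot (hT h)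
    have hbs := Finset.mem_of_mem_erase hb
    refine ⟨insert a T, Finset.insert_subset has (hT.trans (s.erase_subset a)), b, hbs,
      by rw [Finset.card_insert_of_notMem haT, hcard], hb₀, ?_, ?_, ?_⟩
    · intro i hi
      rcases Finset.mem_insert.1 hi with rfl | hi
      exacts [ha b hbs, hTb i hi]
    · intro i hi
      have h₁ := hrest i (by grind)
      have h₂ : ((s.erase a).card : ℝ) ≤ s.card := by exact_mod_cast Finset.card_erase_le
      nlinarith
    · rw [Finset.prod_insert haT, ← Finset.insert_erase has, esymmOn_insert hnot]
      nlinarith [hpos (k + 1) le_rfl, ha b hbs]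

/-- If the entries over `T` are at least `c > 0` and the others are at most `N * c` in absolute
value, then products over larger sets are controlled by the product over `T`. -/
theorem prod_le_of_card_eq {T t : Finset ι} {c N : ℝ} {d : ℕ} (hc : 0 < c) (hN : 1 ≤ N)
    (hT : ∀ i ∈ T, c ≤ x i) (ht : ∀ i ∈ t \ T, |x i| ≤ N * c) (hcard : t.card = T.card + d) :
    ∏ i ∈ t, x i ≤ N ^ t.card * ((∏ i ∈ T, x i) * c ^ d) := by
  have h₁ : (t \ T).card = (T \ t).card + d := by
    have := Finset.card_sdiff_add_card_inter t T
    have := Finset.card_sdiff_add_card_inter T t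
    rw [Finset.inter_comm] at this
    omega
  have h₂ : c ^ (T \ t).card ≤ ∏ i ∈ T \ t, x i := by
    rw [← Finset.prod_const]
    exact Finset.prod_le_prod (fun _ _ => hc.le) fun i hi => hT i (Finset.sdiff_subset hi)
  have h₃ : ∏ i ∈ t \ T, x i ≤ N ^ t.card * c ^ (t \ T).card := calc
    ∏ i ∈ t \ T, x i ≤ ∏ i ∈ t \ T, |x i| := (le_abs_self _).trans (Finset.abs_prod _ _).le
    _ ≤ ∏ i ∈ t \ T, N * c := Finset.prod_le_prod (fun _ _ => abs_nonneg _) ht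
    _ = N ^ (t \ T).card * c ^ (t \ T).card := by rw [Finset.prod_const, mul_pow]
    _ ≤ N ^ t.card * c ^ (t \ T).card := by
      gcongr ?_ * _
      exact pow_le_pow_right₀ hN (Finset.card_le_card Finset.sdiff_subset)
  have h₄ : 0 ≤ ∏ i ∈ t ∩ T, x i := Finset.prod_nonneg fun i hi =>
    hc.le.trans (hT i (Finset.mem_inter.1 hi).2)
  calc
    ∏ i ∈ t, x i = (∏ i ∈ t ∩ T, x i) * ∏ i ∈ t \ T, x i :=
      (Finset.prod_inter_mul_prod_sdiff t T x).symm
    _ ≤ (∏ i ∈ t ∩ T, x i) * (N ^ t.card * (c ^ (T \ t).card * c ^ d)) := by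
      rw [h₁, pow_add] at h₃
      gcongr
    _ ≤ (∏ i ∈ t ∩ T, x i) * (N ^ t.card * ((∏ i ∈ T \ t, x i) * c ^ d)) := by gcongr
    _ = N ^ t.card * ((∏ i ∈ T, x i) * c ^ d) := by
      rw [← Finset.prod_inter_mul_prod_sdiff T t x, Finset.inter_comm T t]
      ring

theorem mul_esymmOn_erase_le {s T : Finset ι} {a : ι} {c : ℝ} {d k : ℕ} (ha : a ∈ s)
    (hc : 0 < c) (hT : ∀ i ∈ T, c ≤ x i) (hs : ∀ i ∈ s \ T, |x i| ≤ s.card * c)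
    (hcard : k + 1 = T.card + d) :
    x a * esymmOn x (s.erase a) k ≤
      2 ^ s.card * s.card ^ (k + 1) * ((∏ i ∈ T, x i) * c ^ d) := by
  have hN : (1 : ℝ) ≤ s.card := by exact_mod_cast Finset.card_pos.2 ⟨a, ha⟩
  have hP : 0 ≤ ∏ i ∈ T, x i := Finset.prod_nonneg fun i hi => hc.le.trans (hT i hi)
  rw [← sum_prod_insert (s.notMem_erase a)]
  refine (Finset.sum_le_card_nsmul _ _ (s.card ^ (k + 1) * ((∏ i ∈ T, x i) * c ^ d)) ?_).trans ?_
  · intro t ht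
    obtain ⟨hts, htc⟩ := Finset.mem_powersetCard.1 ht
    have hc' : (insert a t).card = k + 1 := by
      rw [Finset.card_insert_of_notMem fun h => s.notMem_erase a (hts h), htc]
    have := prod_le_of_card_eq (t := insert a t) hc hN hT
      (fun i hi => hs i (by grind)) (hc'.trans hcard)
    rwa [hc'] at this
  · rw [nsmul_eq_mul, mul_assoc]
    gcongr
    have h₁ : ((s.erase a).powersetCard k).card ≤ 2 ^ s.card := by
      rw [← Finset.card_powerset]
      exact Finset.card_le_card fun t ht => Finset.mem_powerset.2
        ((Finset.mem_powersetCard.1 ht).1.trans (s.erase_subset a))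
    exact_mod_cast h₁

end esymmOn

theorem esymmZ_natCast (n k : ℕ) (lam : Fin n → ℝ) :
    esymmZ n k lam = esymmOn lam Finset.univ k := by
  simp [esymmZ, esymmOn]

theorem esymmDel_natCast (n k : ℕ) (lam : Fin n → ℝ) (i : Fin n) :
    esymmDel n k lam i = esymmOn lam (Finset.univ.erase i) k := by
  simp [esymmDel, esymmOn]

theorem C0_Sk_ge_lam_i_Skii
    (n : ℕ) (hn : 2 ≤ n) (k : ℕ) (hk1 : 2 ≤ k) (hk : k ≤ n)
    (α : ℝ) (hα : 0 < α) (N₀ : ℝ) (hN₀ : 0 < N₀) :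
    ∃ C₀ : ℝ, 0 < C₀ ∧
      ∀ lam : Fin n → ℝ, lam ∈ Gamma n k → Antitone lam → SZ n α k lam ≤ N₀ →
        ∀ i : Fin n, C₀ * SZ n α k lam ≥ lam i * SDel n α ((k : ℤ) - 1) lam i := by
  obtain ⟨m, rfl⟩ := Nat.exists_eq_add_of_le' hk1
  have hn' : (1 : ℝ) ≤ n := by exact_mod_cast (by omega : 1 ≤ n)
  refine ⟨2 ^ n * n ^ (m + 2) * (1 + N₀ / α + α) / α, by positivity, ?_⟩
  intro lam hΓ _ hS i
  have e₁ : ((m + 2 : ℕ) : ℤ) - 1 = (m + 1 : ℕ) := by push_cast; ring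
  have e₂ : ((m + 1 : ℕ) : ℤ) - 1 = m := by push_cast; ring
  have hpos : ∀ j ≤ m + 1 + 1, 0 < esymmOn lam Finset.univ j := by
    rintro (_ | j) hj
    · simp [esymmOn_zero]
    · rw [← esymmZ_natCast]
      exact hΓ (j + 1) (by omega) hj
  rw [SZ, e₁, esymmZ_natCast, esymmZ_natCast] at hS ⊢
  rw [SDel, e₂, esymmDel_natCast, esymmDel_natCast, ge_iff_le]
  obtain ⟨T, -, b, -, hcard, hb, hTb, hrest, hprod⟩ := exists_prod_le_esymmOn (m + 1) _ hpos
  set S := esymmOn lam Finset.univ (m + 2) + α * esymmOn lam Finset.univ (m + 1)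
  set P := ∏ j ∈ T, lam j
  have hPS : α * P ≤ S := by
    have := mul_le_mul_of_nonneg_left hprod hα.le
    have := hpos (m + 2) le_rfl
    simp only [S]
    linarith
  have hP : 0 < P := Finset.prod_pos fun j hj => hb.trans_le (hTb j hj)
  have hbP : lam b ^ (m + 1) ≤ P := by
    rw [← hcard, ← Finset.prod_const]
    exact Finset.prod_le_prod (fun _ _ => hb.le) hTb
  have hbM : lam b ≤ 1 + N₀ / α := by
    have hPN : P ≤ N₀ / α := (le_div_iff₀' hα).2 (hPS.trans hS)
    rcases le_total (lam b) 1 with h | h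
    · have : 0 < N₀ / α := by positivity
      linarith
    · have := le_self_pow₀ h m.succ_ne_zero
      exact (this.trans (hbP.trans hPN)).trans (by linarith)
  have h₁ := mul_esymmOn_erase_le (d := 1) (k := m + 1) (Finset.mem_univ i) hb hTb hrest (by omega)
  have h₀ := mul_esymmOn_erase_le (d := 0) (k := m) (Finset.mem_univ i) hb hTb hrest (by omega)
  rw [Finset.card_univ, Fintype.card_fin] at h₁ h₀
  rw [pow_one] at h₁
  rw [pow_zero, mul_one] at h₀
  calc
    lam i * (esymmOn lam (Finset.univ.erase i) (m + 1) +
        α * esymmOn lam (Finset.univ.erase i) m)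
      = lam i * esymmOn lam (Finset.univ.erase i) (m + 1) +
        α * (lam i * esymmOn lam (Finset.univ.erase i) m) := by ring
    _ ≤ 2 ^ n * n ^ (m + 2) * (P * (1 + N₀ / α)) + α * (2 ^ n * n ^ (m + 2) * P) := by
      refine add_le_add (h₁.trans (by gcongr)) (mul_le_mul_of_nonneg_left (h₀.trans ?_) hα.le)
      gcongr ?_ * _
      exact mul_le_mul_of_nonneg_left (pow_le_pow_right₀ hn' (by omega)) (by positivity)
    _ = 2 ^ n * n ^ (m + 2) * (1 + N₀ / α + α) / α * (α * P) := by field_simp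
    _ ≤ 2 ^ n * n ^ (m + 2) * (1 + N₀ / α + α) / α * S := by gcongr
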